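/- arXiv:1802.07635 — 7 statements merged into one kernel-verified Lean document; each statement's English description precedes it below -/
import Mathlib

section
/- Let R be a Bézout domain, p a prime element of R, and n ≥ 2 an integer, and set Λ = R/⟨p^n⟩. Then every finitely generated Λ-module is isomorphic to a finite direct sum of cyclic modules of the form V_i = R/⟨p^i⟩ with 1 ≤ i ≤ n; moreover this decomposition is unique, i.e. if two finite multisets of indices i_1,…,i_r and j_1,…,j_s in {1,…,n} satisfy V_{i_1} ⊕ … ⊕ V_{i_r} ≅ V_{j_1} ⊕ … ⊕ V_{j_s} as Λ-modules, then the multisets coincide. -/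
/-- The quotient ring `Λ = R/⟨p^n⟩`. -/
abbrev Lam (R : Type*) [CommRing R] (p : R) (n : ℕ) : Type _ :=
  R ⧸ (Ideal.span {p ^ n} : Ideal R)

/-- The cyclic `Λ`-module `V_i = R/⟨p^i⟩`, realized as the quotient of `Λ` by the ideal
generated by the image of `p^i` (the `Λ`-module structure being the one induced by the
natural surjection `Λ → R/⟨p^i⟩`). -/
abbrev Vmod (R : Type*) [CommRing R] (p : R) (n i : ℕ) : Type _ :=
  Lam R p n ⧸
    (Ideal.span {Ideal.Quotient.mk (Ideal.span {p ^ n} : Ideal R) (p ^ i)} :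
      Ideal (Lam R p n))

open scoped DirectSum

theorem Submodule.span_range_mkQ_succAbove {A M : Type*} [CommRing A] [AddCommGroup M]
    [Module A M] {d : ℕ} {s : Fin (d + 1) → M}
    (hs : Submodule.span A (Set.range s) = ⊤) (j : Fin (d + 1)) :
    Submodule.span A (Set.range fun i => (Submodule.span A {s j}).mkQ (s (j.succAbove i))) =
      ⊤ := by
  rw [eq_top_iff, ← (Submodule.span A {s j}).range_mkQ, ← Submodule.map_top, ← hs,
    Submodule.map_span, Submodule.span_le]
  rintro _ ⟨_, ⟨i, rfl⟩, rfl⟩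
  obtain rfl | ⟨i, rfl⟩ := j.eq_self_or_eq_succAbove i
  · rw [(Submodule.mkQ_apply _ _).trans
      ((Submodule.Quotient.mk_eq_zero _).mpr (Submodule.mem_span_singleton_self _))]
    exact zero_mem _
  · exact Submodule.subset_span ⟨i, rfl⟩

theorem LinearEquiv.length_range_lsmul_eq {A M N : Type*} [CommRing A] [AddCommGroup M]
    [Module A M] [AddCommGroup N] [Module A N] (e : M ≃ₗ[A] N) (a : A) :
    Module.length A (LinearMap.range (LinearMap.lsmul A M a)) =
      Module.length A (LinearMap.range (LinearMap.lsmul A N a)) := by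
  have h : (LinearMap.range (LinearMap.lsmul A M a)).map (e : M →ₗ[A] N) =
      LinearMap.range (LinearMap.lsmul A N a) := by
    ext y
    constructor
    · rintro ⟨_, ⟨x, rfl⟩, rfl⟩
      exact ⟨e x, by simp⟩
    · rintro ⟨y, rfl⟩
      exact ⟨_, ⟨e.symm y, rfl⟩, by simp⟩
  rw [← h]
  exact (e.submoduleMap _).length_eq

theorem card_fiber_add_two_mul_sum_sub {α : Type*} [Fintype α] (u : α → ℕ) (a : ℕ) :
    Fintype.card {k // u k = a + 1} + 2 * ∑ k, (u k - (a + 1)) =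
      ∑ k, (u k - a) + ∑ k, (u k - (a + 2)) := by
  rw [Fintype.card_subtype, Finset.card_filter, Finset.mul_sum, ← Finset.sum_add_distrib,
    ← Finset.sum_add_distrib]
  refine Finset.sum_congr rfl fun k _ => ?_
  split_ifs <;> lia

/-- A finite family of natural numbers is determined up to reindexing by its truncated sums. -/
theorem exists_equiv_of_forall_sum_sub_eq {ι κ : Type*} [Fintype ι] [Fintype κ] {f : ι → ℕ}
    {g : κ → ℕ} (hf : ∀ k, 1 ≤ f k) (hg : ∀ k, 1 ≤ g k)
    (h : ∀ i, ∑ k, (f k - i) = ∑ k, (g k - i)) : ∃ e : ι ≃ κ, ∀ k, f k = g (e k) := by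
  classical
  have hcard (a : ℕ) : Fintype.card {k // f k = a} = Fintype.card {k // g k = a} := by
    cases a with
    | zero =>
      have : IsEmpty {k // f k = 0} := ⟨fun k => by have := hf k.1; have := k.2; lia⟩
      have : IsEmpty {k // g k = 0} := ⟨fun k => by have := hg k.1; have := k.2; lia⟩
      rw [Fintype.card_eq_zero, Fintype.card_eq_zero]
    | succ a =>
      have hf' := card_fiber_add_two_mul_sum_sub f a
      have hg' := card_fiber_add_two_mul_sum_sub g a
      rw [h, h, h] at hf'
      lia
  let e := (Equiv.sigmaFiberEquiv f).symm.trans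
    ((Equiv.sigmaCongrRight fun a => Fintype.equivOfCardEq (hcard a)).trans
      (Equiv.sigmaFiberEquiv g))
  exact ⟨e, fun k => (Fintype.equivOfCardEq (hcard (f k)) ⟨k, rfl⟩).2.symm⟩

section PrimePower

variable {R : Type*} [CommRing R] [IsDomain R] {p : R}

theorem Module.exists_pow_smul_eq_of_pow_smul_mem_span {M : Type*} [AddCommGroup M] [Module R M]
    (hp : Prime p) {y : M} {m : ℕ}
    (hM : Module.IsTorsionBy R M (p ^ m)) (hy : Ideal.torsionOf R M y = Ideal.span {p ^ m})
    {x : M} {k : ℕ} (hx : p ^ k • x ∈ Submodule.span R {y}) :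
    ∃ b : R, p ^ k • x = p ^ k • b • y := by
  obtain hk | hk := le_total k m
  · obtain ⟨a, ha⟩ := Submodule.mem_span_singleton.mp hx
    have hmem : p ^ (m - k) * a ∈ Ideal.torsionOf R M y := by
      rw [Ideal.mem_torsionOf_iff, mul_smul, ha, smul_smul, ← pow_add, Nat.sub_add_cancel hk]
      exact @hM x
    rw [hy, Ideal.mem_span_singleton, ← Nat.sub_add_cancel hk, pow_add, Nat.add_sub_cancel,
      mul_dvd_mul_iff_left (pow_ne_zero _ hp.ne_zero)] at hmem
    obtain ⟨b, rfl⟩ := hmem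
    exact ⟨b, by rw [← ha, mul_smul]⟩
  · refine ⟨0, ?_⟩
    rw [zero_smul, smul_zero, ← Nat.sub_add_cancel hk, pow_add, mul_smul, @hM x, smul_zero]

/-- Multiplication by `p ^ i`, as a map `R ⧸ ⟨p ^ (a - i)⟩ → R ⧸ ⟨p ^ a⟩`. -/
noncomputable def Ideal.quotientSpanPowMul {R : Type*} [CommRing R] (p : R) (i a : ℕ) :
    (R ⧸ Ideal.span {p ^ (a - i)}) →ₗ[R] R ⧸ Ideal.span {p ^ a} :=
  Submodule.mapQ _ _ (LinearMap.lsmul R R (p ^ i)) fun x hx => by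
    rw [Ideal.mem_span_singleton] at hx
    rw [Submodule.mem_comap, LinearMap.lsmul_apply, smul_eq_mul, Ideal.mem_span_singleton]
    exact (pow_dvd_pow p (by lia : a ≤ i + (a - i))).trans
      (pow_add p i (a - i) ▸ mul_dvd_mul_left _ hx)

theorem Ideal.quotientSpanPowMul_injective (hp : Prime p) (i a : ℕ) :
    Function.Injective (Ideal.quotientSpanPowMul p i a) := by
  rw [injective_iff_map_eq_zero]
  intro x hx
  obtain ⟨x, rfl⟩ := Submodule.Quotient.mk_surjective _ x
  rw [Ideal.quotientSpanPowMul, Submodule.mapQ_apply, Submodule.Quotient.mk_eq_zero,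
    LinearMap.lsmul_apply, smul_eq_mul, Ideal.mem_span_singleton] at hx
  rw [Submodule.Quotient.mk_eq_zero, Ideal.mem_span_singleton]
  obtain h | h := le_total i a
  · rwa [← pow_mul_pow_sub p h, mul_dvd_mul_iff_left (pow_ne_zero _ hp.ne_zero)] at hx
  · simp [Nat.sub_eq_zero_of_le h]

/-- A module killed by `p ^ m` whose quotient by the cyclic submodule
`R ∙ z` decomposes, with `z` of maximal order, decomposes itself. -/
theorem Module.nonempty_equiv_prod_of_quotient_equiv {M : Type*} [AddCommGroup M] [Module R M]
    (hp : Prime p) {z : M} {m : ℕ}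
    (hM : Module.IsTorsionBy R M (p ^ m)) (hz : Ideal.torsionOf R M z = Ideal.span {p ^ m})
    {d : ℕ} {k : Fin d → ℕ}
    (f : (M ⧸ Submodule.span R {z}) ≃ₗ[R] ((i : Fin d) → R ⧸ Ideal.span {p ^ k i})) :
    Nonempty (M ≃ₗ[R] (R ⧸ Ideal.span {p ^ m}) × ((i : Fin d) → R ⧸ Ideal.span {p ^ k i})) := by
  have hlift (i : Fin d) : ∃ x : M, p ^ k i • x = 0 ∧
      f (Submodule.Quotient.mk x) = Pi.single i 1 := by
    obtain ⟨x, hx⟩ := Submodule.Quotient.mk_surjective _ (f.symm (Pi.single i 1))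
    have hmem : p ^ k i • x ∈ Submodule.span R {z} := by
      rw [← Submodule.Quotient.mk_eq_zero, Submodule.Quotient.mk_smul, hx, ← map_smul,
        ← Pi.single_smul, LinearEquiv.map_eq_zero_iff, Pi.single_eq_zero_iff]
      refine (Submodule.Quotient.mk_eq_zero _).mpr ?_
      simp
    obtain ⟨b, hb⟩ := Module.exists_pow_smul_eq_of_pow_smul_mem_span hp hM hz hmem
    refine ⟨x - b • z, by rw [smul_sub, hb, sub_self], ?_⟩
    rw [Submodule.Quotient.mk_sub, (Submodule.Quotient.mk_eq_zero _).mpr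
      (Submodule.smul_mem _ b (Submodule.mem_span_singleton_self z)), sub_zero, hx,
      LinearEquiv.apply_symm_apply]
  choose x hx0 hx using hlift
  let σ : ((i : Fin d) → R ⧸ Ideal.span {p ^ k i}) →ₗ[R] M :=
    LinearMap.lsum R _ R fun i =>
      Submodule.liftQSpanSingleton (p ^ k i) (LinearMap.toSpanSingleton R M (x i)) (hx0 i)
  refine ⟨(lequivProdOfRightSplitExact (f := σ)
    (g := f.toLinearMap.comp (Submodule.mkQ _))
    (Submodule.span R {z}).injective_subtype ?_ ?_).symm ≪≫ₗ
    ((Ideal.quotTorsionOfEquivSpanSingleton R M z).symm ≪≫ₗ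
      Submodule.quotEquivOfEq _ _ hz).prodCongr (.refl _ _)⟩
  · rw [Submodule.range_subtype, LinearEquiv.ker_comp, Submodule.ker_mkQ]
  · refine LinearMap.pi_ext' fun i => Submodule.linearMap_qext _ (LinearMap.ext_ring ?_)
    simp only [LinearMap.comp_apply, LinearMap.id_apply, LinearEquiv.coe_coe, Submodule.mkQ_apply,
      LinearMap.coe_single]
    have hσ : σ (Pi.single i (Submodule.Quotient.mk 1)) = x i := by
      simp only [σ, LinearMap.lsum_piSingle]
      exact one_smul R (x i)
    rw [hσ, hx]
    rfl

variable [IsBezout R]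

/-- In a Bézout domain, an ideal containing a power of a prime `p` is generated by the least
power of `p` it contains. -/
theorem Ideal.eq_span_pow_of_forall_lt_notMem (hp : Prime p) {I : Ideal R} {m : ℕ}
    (hm : p ^ m ∈ I) (hlt : ∀ j < m, p ^ j ∉ I) : I = Ideal.span {p ^ m} := by
  refine le_antisymm (fun x hx => ?_) ((Ideal.span_singleton_le_iff_mem I).mpr hm)
  have hle : Ideal.span {x, p ^ m} ≤ I := by
    rw [Ideal.span_le]
    rintro y (rfl | rfl)
    exacts [hx, hm]
  obtain ⟨d, hd⟩ := IsBezout.span_pair_isPrincipal x (p ^ m)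
  rw [Ideal.submodule_span_eq] at hd
  have hdx : d ∣ x :=
    Ideal.mem_span_singleton.mp (hd ▸ Ideal.subset_span (Set.mem_insert _ _))
  have hdp : d ∣ p ^ m :=
    Ideal.mem_span_singleton.mp (hd ▸ Ideal.subset_span (Set.mem_insert_of_mem _ rfl))
  have hdI : d ∈ I := hle (hd ▸ Ideal.mem_span_singleton_self d)
  obtain ⟨j, hj, hassoc⟩ := (dvd_prime_pow hp m).mp hdp
  have hjI : p ^ j ∈ I := I.mem_of_dvd hassoc.dvd hdI
  have hmj : m = j := le_antisymm (not_lt.mp fun h => hlt j h hjI) hj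
  exact Ideal.mem_span_singleton.mpr (hmj ▸ hassoc.symm.dvd.trans hdx)

theorem Prime.isMaximal_span_of_isBezout (hp : Prime p) : (Ideal.span {p}).IsMaximal := by
  refine Ideal.isMaximal_def.mpr ⟨fun h => hp.not_isUnit (Ideal.span_singleton_eq_top.mp h), ?_⟩
  intro I hI
  by_contra hne
  refine hI.ne' ?_
  rw [← pow_one p]
  refine Ideal.eq_span_pow_of_forall_lt_notMem hp ?_ ?_
  · rw [pow_one]
    exact hI.le (Ideal.mem_span_singleton_self p)
  · intro j hj hmem
    obtain rfl : j = 0 := by lia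
    rw [pow_zero] at hmem
    exact hne ((Ideal.eq_top_iff_one I).mpr hmem)

theorem Prime.length_quotient_span_pow (hp : Prime p) (a : ℕ) :
    Module.length R (R ⧸ Ideal.span {p ^ a}) = a := by
  have := hp.isMaximal_span_of_isBezout
  have hsimple : IsSimpleModule R (R ⧸ Ideal.span {p}) :=
    isSimpleModule_iff_isCoatom.mpr (Ideal.isMaximal_def.mp this)
  have h := Ring.ord_pow (mem_nonZeroDivisors_of_ne_zero hp.ne_zero) a
  rw [Ring.ord, Ring.ord, Module.length_eq_one R (R ⧸ Ideal.span {p})] at h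
  simpa using h

section Existence

variable {M : Type*} [AddCommGroup M] [Module R M]

theorem Module.exists_torsionOf_eq_span_pow (hp : Prime p) [Nontrivial M] {n d : ℕ}
    (hM : Module.IsTorsionBy R M (p ^ n)) {s : Fin d → M}
    (hs : Submodule.span R (Set.range s) = ⊤) :
    ∃ (m : ℕ) (j : Fin d), 1 ≤ m ∧ m ≤ n ∧ Module.IsTorsionBy R M (p ^ m) ∧
      Ideal.torsionOf R M (s j) = Ideal.span {p ^ m} := by
  classical
  have hex : ∃ m, Module.IsTorsionBy R M (p ^ m) := ⟨n, hM⟩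
  obtain ⟨m, hm, hmin⟩ : ∃ m, Module.IsTorsionBy R M (p ^ m) ∧
      ∀ j < m, ¬ Module.IsTorsionBy R M (p ^ j) :=
    ⟨Nat.find hex, Nat.find_spec hex, fun _ => Nat.find_min hex⟩
  have hm1 : 1 ≤ m := by
    refine Nat.one_le_iff_ne_zero.mpr ?_
    rintro rfl
    obtain ⟨x, hx⟩ := exists_ne (0 : M)
    exact hx (by simpa using @hm x)
  obtain ⟨j, hj⟩ : ∃ j, p ^ (m - 1) • s j ≠ 0 := by
    by_contra! h
    refine hmin (m - 1) (by lia) fun {x} => ?_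
    have hle : Submodule.span R (Set.range s) ≤ Submodule.torsionBy R M (p ^ (m - 1)) :=
      Submodule.span_le.mpr (Set.range_subset_iff.mpr h)
    exact hle (hs ▸ Submodule.mem_top)
  refine ⟨m, j, hm1, not_lt.mp fun h => hmin n h hM, hm,
    Ideal.eq_span_pow_of_forall_lt_notMem hp ?_ ?_⟩
  · exact @hm (s j)
  · intro i hi hmem
    apply hj
    rw [show m - 1 = m - 1 - i + i by lia, pow_add, mul_smul,
      (Ideal.mem_torsionOf_iff (s j) (p ^ i)).mp hmem, smul_zero]

/-- A finitely generated module over a Bézout domain killed by a power of a prime is a finite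
direct sum of cyclic modules. -/
theorem Module.exists_equiv_pi_quotient_span_pow (hp : Prime p) (n : ℕ) [Module.Finite R M]
    (hM : Module.IsTorsionBy R M (p ^ n)) :
    ∃ (r : ℕ) (k : Fin r → ℕ), (∀ i, 1 ≤ k i ∧ k i ≤ n) ∧
      Nonempty (M ≃ₗ[R] ((i : Fin r) → R ⧸ Ideal.span {p ^ k i})) := by
  obtain ⟨d, s, hs⟩ := Module.Finite.exists_fin (R := R) (M := M)
  have htriv (N : Type _) [AddCommGroup N] [Module R N] [Subsingleton N] :
      ∃ (r : ℕ) (k : Fin r → ℕ), (∀ i, 1 ≤ k i ∧ k i ≤ n) ∧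
        Nonempty (N ≃ₗ[R] ((i : Fin r) → R ⧸ Ideal.span {p ^ k i})) :=
    ⟨0, finZeroElim, finZeroElim, ⟨0⟩⟩
  induction d generalizing M with
  | zero =>
    have : Subsingleton M := by
      rw [Set.range_eq_empty, Submodule.span_empty] at hs
      exact (Submodule.subsingleton_iff R).mp (subsingleton_of_bot_eq_top hs)
    exact htriv M
  | succ d ih =>
    obtain h | h := subsingleton_or_nontrivial M
    · exact htriv M
    obtain ⟨m, j, hm1, hmn, hm, hz⟩ := Module.exists_torsionOf_eq_span_pow hp hM hs
    obtain ⟨r, k, hk, ⟨f⟩⟩ := ih (M := M ⧸ Submodule.span R {s j})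
      (fun {x} => by
        obtain ⟨x, rfl⟩ := Submodule.Quotient.mk_surjective _ x
        rw [← Submodule.Quotient.mk_smul, @hM x, Submodule.Quotient.mk_zero])
      _ (Submodule.span_range_mkQ_succAbove hs j)
    obtain ⟨e⟩ := Module.nonempty_equiv_prod_of_quotient_equiv hp hm hz f
    refine ⟨r + 1, Fin.cons m k, Fin.cases ⟨hm1, hmn⟩ hk, ⟨e ≪≫ₗ ?_⟩⟩
    exact Fin.consLinearEquiv R
      (fun i : Fin (r + 1) => R ⧸ Ideal.span {p ^ (Fin.cons m k : Fin (r + 1) → ℕ) i})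

end Existence

theorem Prime.length_range_pow_smul_pi (hp : Prime p) {ι : Type*} [Fintype ι] (f : ι → ℕ)
    (i : ℕ) :
    Module.length R (LinearMap.range
      (LinearMap.lsmul R ((k : ι) → R ⧸ Ideal.span {p ^ f k}) (p ^ i))) =
      ((∑ k, (f k - i) : ℕ) : ℕ∞) := by
  let φ : ((k : ι) → R ⧸ Ideal.span {p ^ (f k - i)}) →ₗ[R] (k : ι) → R ⧸ Ideal.span {p ^ f k} :=
    LinearMap.piMap fun k => Ideal.quotientSpanPowMul p i (f k)
  have hφ : Function.Injective φ :=
    Function.Injective.piMap fun k => Ideal.quotientSpanPowMul_injective hp i (f k)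
  have hrange : LinearMap.range φ = LinearMap.range
      (LinearMap.lsmul R ((k : ι) → R ⧸ Ideal.span {p ^ f k}) (p ^ i)) := by
    ext y
    constructor
    · rintro ⟨x, rfl⟩
      choose c hc using fun k => Submodule.Quotient.mk_surjective _ (x k)
      obtain rfl : (fun k => Submodule.Quotient.mk (c k)) = x := funext hc
      exact ⟨fun k => Submodule.Quotient.mk (c k), rfl⟩
    · rintro ⟨x, rfl⟩
      choose c hc using fun k => Submodule.Quotient.mk_surjective _ (x k)
      obtain rfl : (fun k => Submodule.Quotient.mk (c k)) = x := funext hc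
      exact ⟨fun k => Submodule.Quotient.mk (c k), rfl⟩
  rw [← hrange, ← (LinearEquiv.ofInjective φ hφ).length_eq, Module.length_pi_of_fintype,
    Nat.cast_sum]
  exact Finset.sum_congr rfl fun k _ => hp.length_quotient_span_pow _

theorem Prime.exists_equiv_of_pi_quotient_span_pow_equiv (hp : Prime p) {ι κ : Type*} [Fintype ι]
    [Fintype κ] {f : ι → ℕ} {g : κ → ℕ} (hf : ∀ k, 1 ≤ f k) (hg : ∀ k, 1 ≤ g k)
    (e : ((k : ι) → R ⧸ Ideal.span {p ^ f k}) ≃ₗ[R] ((k : κ) → R ⧸ Ideal.span {p ^ g k})) :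
    ∃ e : ι ≃ κ, ∀ k, f k = g (e k) := by
  refine exists_equiv_of_forall_sum_sub_eq hf hg fun i => ?_
  have h := e.length_range_lsmul_eq (p ^ i)
  rw [hp.length_range_pow_smul_pi, hp.length_range_pow_smul_pi] at h
  exact_mod_cast h

end PrimePower

/-- For `i ≤ n`, the module `V_i` is `R ⧸ ⟨p ^ i⟩` as an `R`-module. -/
noncomputable def Vmod.equivQuotientSpanPow {R : Type*} [CommRing R] (p : R) {n i : ℕ}
    (hi : i ≤ n) : Vmod R p n i ≃ₗ[R] R ⧸ Ideal.span {p ^ i} :=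
  (Submodule.quotEquivOfEq _ _ (by
    rw [Ideal.map_span, Set.image_singleton]; rfl) |>.restrictScalars R) ≪≫ₗ
  (DoubleQuot.quotQuotEquivQuotOfLEₐ R (I := Ideal.span {p ^ n}) (J := Ideal.span {p ^ i})
    (Ideal.span_singleton_le_span_singleton.mpr (pow_dvd_pow p hi))).toLinearEquiv

/-- A finite direct sum of modules `V_i` is a product of the `R ⧸ ⟨p ^ i⟩` as an `R`-module. -/
noncomputable def Vmod.directSumEquivPi {R : Type*} [CommRing R] (p : R) {n r : ℕ}
    {f : Fin r → ℕ} (hf : ∀ k, f k ≤ n) :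
    (⨁ k, Vmod R p n (f k)) ≃ₗ[R] ((k : Fin r) → R ⧸ Ideal.span {p ^ f k}) :=
  DirectSum.linearEquivFunOnFintype R (Fin r) (fun k => Vmod R p n (f k)) ≪≫ₗ
    LinearEquiv.piCongrRight fun k => Vmod.equivQuotientSpanPow p (hf k)

/-- Every finitely generated `Λ`-module is a finite direct sum of the cyclic modules
`V_i = R/⟨p^i⟩`, `1 ≤ i ≤ n`, and the multiset of indices appearing in such a
decomposition is unique. -/
theorem finite_module_over_quotient_primePow_decomposition_unique
    {R : Type*} [CommRing R] [IsDomain R] [IsBezout R]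
    (p : R) (hp : Prime p) (n : ℕ) (hn : 2 ≤ n)
    (M : Type*) [AddCommGroup M] [Module (Lam R p n) M] [Module.Finite (Lam R p n) M] :
    (∃ (r : ℕ) (f : Fin r → ℕ), (∀ k, 1 ≤ f k ∧ f k ≤ n) ∧
      Nonempty (M ≃ₗ[Lam R p n] DirectSum (Fin r) fun k => Vmod R p n (f k))) ∧
    (∀ (r s : ℕ) (f : Fin r → ℕ) (g : Fin s → ℕ),
      (∀ k, 1 ≤ f k ∧ f k ≤ n) → (∀ k, 1 ≤ g k ∧ g k ≤ n) →
      Nonempty ((DirectSum (Fin r) fun k => Vmod R p n (f k)) ≃ₗ[Lam R p n]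
        (DirectSum (Fin s) fun k => Vmod R p n (g k))) →
      ∃ e : Fin r ≃ Fin s, ∀ k, f k = g (e k)) := by
  have hsurj : Function.Surjective (algebraMap R (Lam R p n)) := Ideal.Quotient.mk_surjective
  constructor
  · let _ : Module R M := Module.compHom M (algebraMap R (Lam R p n))
    have : IsScalarTower R (Lam R p n) M := IsScalarTower.of_algebraMap_smul fun _ _ => rfl
    have : Module.Finite R M := Module.Finite.trans (Lam R p n) M
    have hM : Module.IsTorsionBy R M (p ^ n) := fun {x} => by
      rw [← algebraMap_smul (Lam R p n) (p ^ n) x, Ideal.Quotient.algebraMap_eq,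
        Ideal.Quotient.eq_zero_iff_mem.mpr (Ideal.mem_span_singleton_self _), zero_smul]
    obtain ⟨r, f, hf, ⟨e⟩⟩ := Module.exists_equiv_pi_quotient_span_pow hp n hM
    refine ⟨r, f, hf, ⟨LinearEquiv.extendScalarsOfSurjective hsurj
      (e ≪≫ₗ (Vmod.directSumEquivPi p fun k => (hf k).2).symm)⟩⟩
  · rintro r s f g hf hg ⟨e⟩
    exact hp.exists_equiv_of_pi_quotient_span_pow_equiv (fun k => (hf k).1) (fun k => (hg k).1)
      ((Vmod.directSumEquivPi p fun k => (hf k).2).symm ≪≫ₗ e.restrictScalars R ≪≫ₗ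
        Vmod.directSumEquivPi p fun k => (hg k).2)
end

section
/- Let R be a Bézout domain, p a prime element of R, and n ≥ 2 an integer. Then Λ = R/⟨p^n⟩ is self-injective: Λ is injective as a module over itself (equivalently, Λ is a commutative Frobenius ring, hence a Gorenstein ring of dimension zero). -/
/-- A nonmultiple of a prime `p` of a Bézout domain is coprime to `p`. -/
lemma isCoprime_of_prime_of_not_dvd {R : Type*} [CommRing R] [IsDomain R] [IsBezout R]
    {p u : R} (hp : Prime p) (hu : ¬ p ∣ u) : IsCoprime p u :=
  isRelPrime_iff_isCoprime.mp (hp.irreducible.isRelPrime_iff_not_dvd.mpr hu)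

/-- Every class modulo `p ^ n` is the product of a power of `p` and a unit. -/
lemma quotient_primePow_exists_eq_pow_mul_unit {R : Type*} [CommRing R] [IsDomain R] [IsBezout R]
    {p : R} (hp : Prime p) (n : ℕ) (x : R ⧸ (Ideal.span {p ^ n} : Ideal R)) :
    ∃ j : ℕ, ∃ u : (R ⧸ (Ideal.span {p ^ n} : Ideal R))ˣ,
      x = Ideal.Quotient.mk (Ideal.span {p ^ n}) p ^ j * u := by
  obtain ⟨x, rfl⟩ := Ideal.Quotient.mk_surjective x
  by_cases hx : p ^ n ∣ x
  · refine ⟨n, 1, ?_⟩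
    rw [Units.val_one, mul_one, ← map_pow, Ideal.Quotient.eq_zero_iff_mem.mpr
      (Ideal.mem_span_singleton.mpr hx), Ideal.Quotient.eq_zero_iff_mem.mpr
      (Ideal.mem_span_singleton_self _)]
  · have hfin : FiniteMultiplicity p x := ⟨n, fun h ↦ hx ((pow_dvd_pow p n.le_succ).trans h)⟩
    obtain ⟨u, hxu, hu⟩ := hfin.exists_eq_pow_mul_and_not_dvd
    obtain ⟨a, b, hab⟩ := (isCoprime_of_prime_of_not_dvd hp hu).pow_left (m := n)
    have hunit : IsUnit (Ideal.Quotient.mk (Ideal.span {p ^ n}) u) := by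
      refine IsUnit.of_mul_eq_one (Ideal.Quotient.mk _ b) ?_
      rw [← map_mul, ← map_one (Ideal.Quotient.mk _), Ideal.Quotient.eq,
        Ideal.mem_span_singleton]
      exact ⟨-a, by linear_combination hab⟩
    refine ⟨multiplicity p x, hunit.unit, ?_⟩
    rw [IsUnit.unit_spec, ← map_pow, ← map_mul, ← hxu]

/-- Modulo `p ^ n`, the annihilator of `p ^ (n - k)` is generated by `p ^ k`. -/
lemma quotient_primePow_dvd_of_pow_mul_eq_zero {R : Type*} [CommRing R] [IsDomain R]
    {p : R} (hp : p ≠ 0) {n k : ℕ} (hk : k ≤ n) {y : R ⧸ (Ideal.span {p ^ n} : Ideal R)}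
    (hy : Ideal.Quotient.mk _ p ^ (n - k) * y = 0) : Ideal.Quotient.mk _ p ^ k ∣ y := by
  obtain ⟨y, rfl⟩ := Ideal.Quotient.mk_surjective y
  rw [← map_pow, ← map_mul, Ideal.Quotient.eq_zero_iff_mem, Ideal.mem_span_singleton] at hy
  rw [← map_pow]
  apply map_dvd
  rw [← Nat.sub_add_cancel hk, pow_add, Nat.sub_add_cancel hk] at hy
  exact (mul_dvd_mul_iff_left (pow_ne_zero _ hp)).mp hy

/-- A ring whose elements are all of the form `π ^ j * u` with `u` a unit, where `π ^ n = 0` and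
`π ^ k` generates the annihilator of `π ^ (n - k)`, is self-injective. -/
lemma Module.injective_self_of_eq_pow_mul_unit {A : Type*} [CommRing A] (π : A) (n : ℕ)
    (hπ : π ^ n = 0) (hunit : ∀ x : A, ∃ j : ℕ, ∃ u : Aˣ, x = π ^ j * u)
    (hann : ∀ k ≤ n, ∀ y : A, π ^ (n - k) * y = 0 → π ^ k ∣ y) :
    Module.Injective A A := by
  classical
  refine Module.Baer.injective fun I f ↦ ?_
  have hex : ∃ k, π ^ k ∈ I := ⟨n, hπ ▸ I.zero_mem⟩
  obtain ⟨k, hkI, hmin⟩ : ∃ k, π ^ k ∈ I ∧ ∀ j, π ^ j ∈ I → k ≤ j :=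
    ⟨Nat.find hex, Nat.find_spec hex, fun j ↦ Nat.find_min' hex⟩
  have hkn : k ≤ n := hmin n (hπ ▸ I.zero_mem)
  obtain ⟨z, hz⟩ := hann k hkn (f ⟨π ^ k, hkI⟩) (by
    rw [← smul_eq_mul, ← map_smul, ← map_zero f]
    congr 1
    ext
    simp [← pow_add, Nat.sub_add_cancel hkn, hπ])
  refine ⟨LinearMap.toSpanSingleton A A z, fun x hx ↦ ?_⟩
  obtain ⟨j, u, rfl⟩ := hunit x
  have hkj : k ≤ j := hmin j ((Ideal.mul_unit_mem_iff_mem I u.isUnit).mp hx)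
  have hfx : (⟨π ^ j * u, hx⟩ : I) = (π ^ (j - k) * u) • ⟨π ^ k, hkI⟩ := by
    ext
    simp only [SetLike.mk_smul_mk, smul_eq_mul]
    rw [mul_right_comm, ← pow_add, Nat.sub_add_cancel hkj]
  rw [hfx, map_smul, hz, LinearMap.toSpanSingleton_apply, smul_eq_mul, smul_eq_mul, ← mul_assoc,
    mul_right_comm (π ^ (j - k)), ← pow_add, Nat.sub_add_cancel hkj]

/-- Let `R` be a Bézout domain, `p` a prime element and `n ≥ 2`. Then `Λ = R/⟨p^n⟩` is
self-injective: it is injective as a module over itself. -/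
theorem quotient_primePow_self_injective
    {R : Type*} [CommRing R] [IsDomain R] [IsBezout R]
    (p : R) (hp : Prime p) (n : ℕ) (hn : 2 ≤ n) :
    Module.Injective (R ⧸ (Ideal.span {p ^ n} : Ideal R))
      (R ⧸ (Ideal.span {p ^ n} : Ideal R)) := by
  refine Module.injective_self_of_eq_pow_mul_unit (Ideal.Quotient.mk _ p) n ?_
    (quotient_primePow_exists_eq_pow_mul_unit hp n)
    fun k hk y ↦ quotient_primePow_dvd_of_pow_mul_eq_zero hp.ne_zero hk
  rw [← map_pow, Ideal.Quotient.eq_zero_iff_mem]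
  exact Ideal.mem_span_singleton_self _
end

section
/- Let R be a Bézout domain, p a prime element of R, and n ≥ 2 an integer, and set Λ = R/⟨p^n⟩ and V_i = R/⟨p^i⟩. For 1 ≤ i, j ≤ n−1, let P(V_i,V_j) ⊆ Hom_Λ(V_i,V_j) be the Λ-submodule of all Λ-linear maps f : V_i → V_j that factor through a finitely generated free Λ-module, i.e. f = h ∘ g for some k ∈ ℕ and Λ-linear maps g : V_i → Λ^k, h : Λ^k → V_j. Then there is an isomorphism of Λ-modules Hom_Λ(V_i,V_j)/P(V_i,V_j) ≅ V_{μ_n(i,j)}, where μ_n(i,j) = min(i, j, n−i, n−j). -/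
open Ideal in
/-- A linear map out of a cyclic module `A/⟨a⟩` factors through a finitely generated free module
if and only if it sends `1` to the image of a multiple of a generator `e` of the annihilator
of `a`. -/
theorem factors_through_free_iff {A : Type*} [CommRing A] {a b e : A}
    (hae : ∀ x, a * x = 0 ↔ e ∣ x)
    (f : (A ⧸ span {a}) →ₗ[A] (A ⧸ span {b})) :
    (∃ (k : ℕ) (g : (A ⧸ span {a}) →ₗ[A] (Fin k → A))
      (h : (Fin k → A) →ₗ[A] (A ⧸ span {b})), f = h ∘ₗ g) ↔
      f (Submodule.Quotient.mk 1) ∈ Submodule.map (Submodule.mkQ (span {b})) (span {e}) := by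
  constructor
  · rintro ⟨k, g, h, rfl⟩
    have hg (l : Fin k) : e ∣ g (Submodule.Quotient.mk 1) l := by
      rw [← hae, ← smul_eq_mul, ← Pi.smul_apply, ← map_smul, ← Submodule.Quotient.mk_smul,
        (Submodule.Quotient.mk_eq_zero _).2 (by simp), map_zero, Pi.zero_apply]
    choose t ht using hg
    obtain ⟨y, hy⟩ := Submodule.mkQ_surjective (span {b}) (h t)
    refine ⟨e * y, mem_span_singleton.2 ⟨y, rfl⟩, ?_⟩
    have hgt : g (Submodule.Quotient.mk 1) = e • t := funext ht
    rw [LinearMap.comp_apply, hgt, map_smul, ← hy, ← map_smul, smul_eq_mul]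
  · rintro ⟨x, hx, hfx⟩
    obtain ⟨s, rfl⟩ := mem_span_singleton.1 hx
    refine ⟨1, Submodule.liftQ (span {a}) (LinearMap.toSpanSingleton A (Fin 1 → A) fun _ => e) ?_,
      LinearMap.toSpanSingleton A _ (Submodule.Quotient.mk s) ∘ₗ LinearMap.proj 0, ?_⟩
    · rw [span_le, Set.singleton_subset_iff]
      ext
      simpa using (hae e).2 dvd_rfl
    · refine Submodule.linearMap_qext _ (LinearMap.ext_ring ?_)
      simp only [LinearMap.comp_apply, Submodule.mkQ_apply, Submodule.liftQ_apply,
        LinearMap.toSpanSingleton_apply, one_smul, LinearMap.proj_apply] at hfx ⊢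
      rw [← hfx, ← smul_eq_mul, Submodule.Quotient.mk_smul]

open Ideal in
/-- If every map `A/⟨a⟩ → A/⟨b⟩` is a multiple of multiplication by `d`, then the maps modulo
those sending `1` into `⟨e⟩` form a cyclic module `A/⟨c⟩`. -/
theorem nonempty_quotient_hom_equiv {A : Type*} [CommRing A] {a b c d e : A}
    (had : ∀ y, b ∣ a * y ↔ d ∣ y)
    (hc : ∀ x, (∃ s, b ∣ e * s - d * x) ↔ c ∣ x) :
    Nonempty ((((A ⧸ span {a}) →ₗ[A] (A ⧸ span {b})) ⧸
      (Submodule.map (Submodule.mkQ (span {b})) (span {e})).comap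
        (LinearMap.applyₗ (R := A) (Submodule.Quotient.mk 1 : A ⧸ span {a}))) ≃ₗ[A]
      (A ⧸ span {c})) := by
  set P := (Submodule.map (Submodule.mkQ (span {b})) (span {e})).comap
    (LinearMap.applyₗ (R := A) (Submodule.Quotient.mk 1 : A ⧸ span {a})) with hP
  let m : (A ⧸ span {a}) →ₗ[A] (A ⧸ span {b}) :=
    Submodule.liftQ (span {a}) (LinearMap.toSpanSingleton A _ (Submodule.Quotient.mk d)) <| by
      rw [span_le, Set.singleton_subset_iff, SetLike.mem_coe, LinearMap.mem_ker,
        LinearMap.toSpanSingleton_apply, ← Submodule.Quotient.mk_smul,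
        Submodule.Quotient.mk_eq_zero, mem_span_singleton, smul_eq_mul]
      exact (had d).2 dvd_rfl
  have hm : m (Submodule.Quotient.mk 1) = Submodule.Quotient.mk d := by
    rw [Submodule.liftQ_apply, LinearMap.toSpanSingleton_apply, one_smul]
  let ψ : A →ₗ[A] _ := P.mkQ ∘ₗ LinearMap.toSpanSingleton A _ m
  have hψ : Function.Surjective ψ := by
    refine (Submodule.mkQ_surjective P).comp fun f => ?_
    obtain ⟨y, hy⟩ := Submodule.mkQ_surjective (span {b}) (f (Submodule.Quotient.mk 1))
    have hby : b ∣ a * y := by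
      rw [← mem_span_singleton, ← smul_eq_mul, ← Submodule.Quotient.mk_eq_zero,
        Submodule.Quotient.mk_smul, ← Submodule.mkQ_apply, hy, ← map_smul,
        ← Submodule.Quotient.mk_smul, (Submodule.Quotient.mk_eq_zero _).2
          (by simp), map_zero]
    obtain ⟨x, rfl⟩ := (had y).1 hby
    refine ⟨x, Submodule.linearMap_qext _ (LinearMap.ext_ring ?_)⟩
    simp only [LinearMap.toSpanSingleton_apply, LinearMap.comp_apply, Submodule.mkQ_apply,
      LinearMap.smul_apply, hm] at hy ⊢
    rw [← hy, ← Submodule.Quotient.mk_smul, smul_eq_mul, mul_comm]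
  have hker : LinearMap.ker ψ = span {c} := by
    ext x
    rw [mem_span_singleton, ← hc, LinearMap.mem_ker, LinearMap.comp_apply, Submodule.mkQ_apply,
      Submodule.Quotient.mk_eq_zero, hP, Submodule.mem_comap, LinearMap.applyₗ_apply_apply,
      LinearMap.toSpanSingleton_apply, LinearMap.smul_apply, hm, ← Submodule.Quotient.mk_smul,
      smul_eq_mul, mul_comm x d]
    simp only [Submodule.mem_map, mem_span_singleton, Submodule.mkQ_apply, Submodule.Quotient.eq]
    exact ⟨fun ⟨_, ⟨s, hs⟩, h⟩ => ⟨s, hs ▸ h⟩, fun ⟨s, h⟩ => ⟨_, ⟨s, rfl⟩, h⟩⟩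
  exact ⟨((Submodule.quotEquivOfEq _ _ hker.symm).trans
    (ψ.quotKerEquivOfSurjective hψ)).symm⟩

/-- Divisibility by powers of `p` up to `p ^ n` can be tested in `R/⟨p^n⟩`. -/
theorem Ideal.Quotient.mk_pow_dvd_mk_iff {R : Type*} [CommRing R] {p : R} {n a : ℕ} (han : a ≤ n)
    (x : R) :
    Ideal.Quotient.mk (Ideal.span {p ^ n}) (p ^ a) ∣ Ideal.Quotient.mk (Ideal.span {p ^ n}) x ↔
      p ^ a ∣ x := by
  refine ⟨fun ⟨y, hy⟩ => ?_, fun h => map_dvd _ h⟩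
  obtain ⟨y, rfl⟩ := Ideal.Quotient.mk_surjective y
  rw [← map_mul, Ideal.Quotient.eq, Ideal.mem_span_singleton] at hy
  exact (dvd_iff_dvd_of_dvd_sub ((pow_dvd_pow p han).trans hy)).2 (dvd_mul_right _ _)

/-- In a domain, `p ^ b` divides `p ^ a * x` exactly when `p ^ (b - a)` divides `x`. -/
theorem pow_dvd_pow_mul_iff {R : Type*} [CommRing R] [IsDomain R] {p : R} (hp : p ≠ 0) (a b : ℕ)
    (x : R) : p ^ b ∣ p ^ a * x ↔ p ^ (b - a) ∣ x := by
  rcases le_total a b with h | h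
  · obtain ⟨c, rfl⟩ := Nat.exists_eq_add_of_le h
    rw [pow_add, mul_dvd_mul_iff_left (pow_ne_zero a hp), Nat.add_sub_cancel_left]
  · simp [Nat.sub_eq_zero_of_le h, (pow_dvd_pow p h).mul_right x]

/-- For `1 ≤ i, j ≤ n-1`, the maps `V_i → V_j` factoring through a finitely generated free
`Λ`-module form a `Λ`-submodule `P(V_i,V_j)` of `Hom_Λ(V_i,V_j)`, and the stable Hom module
`Hom_Λ(V_i,V_j)/P(V_i,V_j)` is isomorphic to `V_{μ_n(i,j)}` with
`μ_n(i,j) = min(i, j, n-i, n-j)`. -/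
theorem stable_hom_between_cyclic_modules
    {R : Type*} [CommRing R] [IsDomain R] [IsBezout R]
    (p : R) (hp : Prime p) (n : ℕ) (hn : 2 ≤ n)
    (i j : ℕ) (hi1 : 1 ≤ i) (hi2 : i ≤ n - 1) (hj1 : 1 ≤ j) (hj2 : j ≤ n - 1) :
    ∃ P : Submodule (Lam R p n) (Vmod R p n i →ₗ[Lam R p n] Vmod R p n j),
      (∀ f : Vmod R p n i →ₗ[Lam R p n] Vmod R p n j,
        f ∈ P ↔ ∃ (k : ℕ) (g : Vmod R p n i →ₗ[Lam R p n] (Fin k → Lam R p n))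
          (h : (Fin k → Lam R p n) →ₗ[Lam R p n] Vmod R p n j), f = h ∘ₗ g) ∧
      Nonempty
        (((Vmod R p n i →ₗ[Lam R p n] Vmod R p n j) ⧸ P) ≃ₗ[Lam R p n]
          Vmod R p n (min (min i j) (min (n - i) (n - j)))) := by
  have hp0 := hp.ne_zero
  refine ⟨_, fun f => (factors_through_free_iff
    (e := Ideal.Quotient.mk (Ideal.span {p ^ n}) (p ^ (n - i))) (fun x => ?_) f).symm,
    nonempty_quotient_hom_equiv
      (d := Ideal.Quotient.mk (Ideal.span {p ^ n}) (p ^ (j - i))) (fun x => ?_) fun x => ?_⟩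
  all_goals obtain ⟨x, rfl⟩ := Ideal.Quotient.mk_surjective x
  · rw [Ideal.Quotient.mk_pow_dvd_mk_iff (Nat.sub_le n i), ← map_mul,
      Ideal.Quotient.eq_zero_iff_mem, Ideal.mem_span_singleton, pow_dvd_pow_mul_iff hp0]
  · rw [← map_mul, Ideal.Quotient.mk_pow_dvd_mk_iff (by lia),
      Ideal.Quotient.mk_pow_dvd_mk_iff (by lia), pow_dvd_pow_mul_iff hp0]
  · have hμ : min (min i j) (min (n - i) (n - j)) = min j (n - i) - (j - i) := by lia
    rw [Ideal.Quotient.mk_surjective.exists, hμ, Ideal.Quotient.mk_pow_dvd_mk_iff (by lia),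
      ← pow_dvd_pow_mul_iff hp0]
    simp only [← map_mul, ← map_sub, Ideal.Quotient.mk_pow_dvd_mk_iff (show j ≤ n by lia)]
    constructor
    · rintro ⟨s, hs⟩
      exact (dvd_iff_dvd_of_dvd_sub ((pow_dvd_pow p (min_le_left _ _)).trans hs)).1
        ((pow_dvd_pow p (min_le_right _ _)).mul_right s)
    · intro h
      rcases le_total j (n - i) with hj | hj
      · exact ⟨0, by simpa [min_eq_left hj] using h⟩
      · rw [min_eq_right hj] at h
        obtain ⟨s, hs⟩ := h
        exact ⟨s, by simp [hs]⟩
end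

section
/- Let R be a valuation domain possessing a prime element p, and let W be a nonzero non-unit of R. Then the following are equivalent: (a) W is critically-finite; (b) W = u·p^n for some unit u of R and some integer n ≥ 2; (c) W ∈ ⟨p^n⟩ \ ⟨p^{n+1}⟩ for some integer n ≥ 2. -/
/-- A nonzero non-unit `W` of a commutative ring is critically-finite if
`W = W₀ · p₁^{n₁} ⋯ p_N^{n_N}` where `N ≥ 1`, each `p_i` is prime, each `n_i ≥ 2`, the `p_i`
are pairwise non-associated in divisibility, `W₀` is squarefree and no `p_i` divides `W₀`. -/
def CriticallyFinite {R : Type*} [CommRing R] (W : R) : Prop :=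
  ∃ (N : ℕ) (W₀ : R) (p : Fin N → R) (e : Fin N → ℕ),
    1 ≤ N ∧ (∀ i, Prime (p i)) ∧ (∀ i, 2 ≤ e i) ∧
    (∀ i j, i ≠ j → ¬(p i ∣ p j ∧ p j ∣ p i)) ∧
    (∀ d : R, d * d ∣ W₀ → IsUnit d) ∧
    (∀ i, ¬ p i ∣ W₀) ∧
    W = W₀ * ∏ i, p i ^ e i

/-- In a valuation domain every element not divisible by a given prime is a unit. -/
theorem Prime.isUnit_of_not_dvd_of_total {R : Type*} [CommRing R] [IsDomain R]
    (hval : ∀ a b : R, ∃ c : R, a * c = b ∨ b * c = a)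
    {p a : R} (hp : Prime p) (h : ¬ p ∣ a) : IsUnit a := by
  obtain ⟨c, hc | hc⟩ := hval p a
  · exact absurd ⟨c, hc.symm⟩ h
  · exact (hp.irreducible.isUnit_or_isUnit hc.symm).resolve_right fun hu =>
      h ((hu.dvd_mul_right).mp (hc ▸ dvd_rfl : p ∣ a * c))

/-- Any two primes of a valuation domain divide each other. -/
theorem Prime.dvd_of_total {R : Type*} [CommRing R] [IsDomain R]
    (hval : ∀ a b : R, ∃ c : R, a * c = b ∨ b * c = a)
    {p q : R} (hp : Prime p) (hq : Prime q) : p ∣ q := by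
  by_contra h
  exact hq.not_isUnit (hp.isUnit_of_not_dvd_of_total hval h)

theorem CriticallyFinite.exists_eq_unit_mul_pow {R : Type*} [CommRing R] [IsDomain R]
    (hval : ∀ a b : R, ∃ c : R, a * c = b ∨ b * c = a)
    {p W : R} (hp : Prime p) (hW : CriticallyFinite W) :
    ∃ (u : R) (n : ℕ), IsUnit u ∧ 2 ≤ n ∧ W = u * p ^ n := by
  obtain ⟨N, W₀, q, e, hN, hq, he, hqq, -, hqW, rfl⟩ := hW
  obtain rfl : N = 1 := by
    by_contra hne
    exact hqq ⟨0, by omega⟩ ⟨1, by omega⟩ (by simp)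
      ⟨(hq _).dvd_of_total hval (hq _), (hq _).dvd_of_total hval (hq _)⟩
  obtain ⟨v, hv⟩ : Associated p (q 0) :=
    associated_of_dvd_dvd (hp.dvd_of_total hval (hq 0)) ((hq 0).dvd_of_total hval hp)
  refine ⟨W₀ * (v : R) ^ e 0, e 0, ?_, he 0, ?_⟩
  · exact ((hq 0).isUnit_of_not_dvd_of_total hval (hqW 0)).mul (v.isUnit.pow _)
  · rw [Fin.prod_univ_one, ← hv]
    ring

theorem criticallyFinite_unit_mul_pow {R : Type*} [CommRing R]
    {p u : R} (hp : Prime p) (hu : IsUnit u) {n : ℕ} (hn : 2 ≤ n) :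
    CriticallyFinite (u * p ^ n) := by
  refine ⟨1, u, fun _ => p, fun _ => n, le_rfl, fun _ => hp, fun _ => hn, ?_, ?_, ?_, by simp⟩
  · exact fun i j hij => absurd (Subsingleton.elim i j) hij
  · exact fun d hd => isUnit_of_dvd_unit ((dvd_mul_right d d).trans hd) hu
  · exact fun _ h => hp.not_isUnit (isUnit_of_dvd_unit h hu)

/-- In a valuation domain, `W` is a unit times `p ^ n` iff `p ^ n` divides `W` exactly. -/
theorem Prime.exists_eq_unit_mul_pow_iff_of_total {R : Type*} [CommRing R] [IsDomain R]
    (hval : ∀ a b : R, ∃ c : R, a * c = b ∨ b * c = a)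
    {p : R} (hp : Prime p) (W : R) (n : ℕ) :
    (∃ u : R, IsUnit u ∧ W = u * p ^ n) ↔ p ^ n ∣ W ∧ ¬ p ^ (n + 1) ∣ W := by
  have key (a : R) : p ^ (n + 1) ∣ a * p ^ n ↔ p ∣ a := by
    rw [pow_succ', mul_dvd_mul_iff_right (pow_ne_zero n hp.ne_zero)]
  constructor
  · rintro ⟨u, hu, rfl⟩
    exact ⟨dvd_mul_left _ _, fun h => hp.not_isUnit (isUnit_of_dvd_unit ((key u).mp h) hu)⟩
  · rintro ⟨⟨a, rfl⟩, h⟩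
    rw [mul_comm, key] at h
    exact ⟨a, hp.isUnit_of_not_dvd_of_total hval h, mul_comm _ _⟩


/-- Let `R` be a valuation domain possessing a prime element `p` and `W` a nonzero non-unit.
Then: `W` is critically-finite ↔ `W = u·p^n` for a unit `u` and some `n ≥ 2`
↔ `W ∈ ⟨p^n⟩ \ ⟨p^{n+1}⟩` for some `n ≥ 2`. -/
theorem valuation_domain_critically_finite_iff
    {R : Type*} [CommRing R] [IsDomain R]
    (hval : ∀ a b : R, ∃ c : R, a * c = b ∨ b * c = a)
    (p : R) (hp : Prime p) (W : R) (hW0 : W ≠ 0) (hWu : ¬ IsUnit W) :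
    (CriticallyFinite W ↔ ∃ (u : R) (n : ℕ), IsUnit u ∧ 2 ≤ n ∧ W = u * p ^ n) ∧
    (CriticallyFinite W ↔ ∃ n : ℕ, 2 ≤ n ∧
      W ∈ (Ideal.span {p ^ n} : Ideal R) ∧ W ∉ (Ideal.span {p ^ (n + 1)} : Ideal R)) := by
  have hab : CriticallyFinite W ↔ ∃ (u : R) (n : ℕ), IsUnit u ∧ 2 ≤ n ∧ W = u * p ^ n := by
    refine ⟨fun h => h.exists_eq_unit_mul_pow hval hp, ?_⟩
    rintro ⟨u, n, hu, hn, rfl⟩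
    exact criticallyFinite_unit_mul_pow hp hu hn
  refine ⟨hab, hab.trans ?_⟩
  simp only [Ideal.mem_span_singleton, ← hp.exists_eq_unit_mul_pow_iff_of_total hval W]
  constructor
  · rintro ⟨u, n, hu, hn, h⟩
    exact ⟨n, hn, u, hu, h⟩
  · rintro ⟨n, hn, u, hu, h⟩
    exact ⟨u, n, hu, hn, h⟩
end

section
/- Let R be an elementary divisor domain, W a nonzero element of R, ρ ≥ 1, and u, v ∈ Mat(ρ,ρ,R) square matrices satisfying u·v = v·u = W·I_ρ. Then there exist invertible matrices A, B ∈ GL(ρ,R) and elements d_1,…,d_ρ, e_1,…,e_ρ ∈ R such that d_i · e_i = W for all i, d_i ∣ d_j whenever i ≤ j, A·v·B⁻¹ = diag(d_1,…,d_ρ), and B·u·A⁻¹ = diag(e_1,…,e_ρ). In particular every finite rank matrix factorization of W is strongly isomorphic to a direct sum of elementary matrix factorizations e_{d_1} ⊕ … ⊕ e_{d_ρ}. -/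
/-- An elementary divisor domain: for all `a b c` there exist `p q x y` such that
`p·x·a + p·y·b + q·y·c` is a greatest common divisor of `a`, `b` and `c`. -/
def IsEDD (R : Type*) [CommRing R] : Prop :=
  ∀ a b c : R, ∃ p q x y : R,
    (p * x * a + p * y * b + q * y * c ∣ a) ∧
    (p * x * a + p * y * b + q * y * c ∣ b) ∧
    (p * x * a + p * y * b + q * y * c ∣ c) ∧
    ∀ d : R, d ∣ a → d ∣ b → d ∣ c → d ∣ p * x * a + p * y * b + q * y * c

open Matrix in
/-- A finite family over a Bézout ring has a linear combination dividing all its members. -/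
theorem exists_dotProduct_dvd {R ι : Type*} [CommRing R] [IsBezout R] [Fintype ι] (a : ι → R) :
    ∃ s : ι → R, ∀ i, s ⬝ᵥ a ∣ a i := by
  have hp : (Ideal.span (Set.range a)).IsPrincipal :=
    IsBezout.isPrincipal_of_FG _ (Submodule.fg_span (Set.finite_range a))
  obtain ⟨g, hg⟩ := hp
  have hmem : g ∈ Ideal.span (Set.range a) := hg ▸ Ideal.mem_span_singleton_self g
  obtain ⟨s, hs⟩ := Ideal.mem_span_range_iff_exists_fun.1 hmem
  refine ⟨s, fun i => ?_⟩
  have hi : a i ∈ Ideal.span (Set.range a) := Ideal.subset_span ⟨i, rfl⟩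
  have hsg : s ⬝ᵥ a = g := hs
  rw [hsg]
  rw [hg] at hi
  exact Ideal.mem_span_singleton.1 hi

/-- Elementary divisor rings are Bézout. -/
theorem IsEDD.isBezout {R : Type*} [CommRing R] (hR : IsEDD R) : IsBezout R := by
  rw [IsBezout.iff_span_pair_isPrincipal]
  intro a b
  obtain ⟨p, q, x, y, ha, hb, -, -⟩ := hR a b 0
  refine ⟨⟨p * x * a + p * y * b + q * y * 0, le_antisymm (Ideal.span_le.2 ?_) ((Ideal.span_singleton_le_iff_mem _).2 ?_)⟩⟩
  · rintro c (rfl | rfl)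
    · exact Ideal.mem_span_singleton.2 ha
    · exact Ideal.mem_span_singleton.2 hb
  · exact Ideal.mem_span_pair.2 ⟨p * x, p * y, by ring⟩

open Matrix in
/-- For a matrix with two rows over an elementary divisor ring, some value of the associated
bilinear form divides all entries. -/
theorem IsEDD.exists_dvd_pair {R ι : Type*} [CommRing R] [Fintype ι] (hR : IsEDD R)
    (a b : ι → R) :
    ∃ (x y : R) (s : ι → R), ∀ i,
      x * (s ⬝ᵥ a) + y * (s ⬝ᵥ b) ∣ a i ∧ x * (s ⬝ᵥ a) + y * (s ⬝ᵥ b) ∣ b i := by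
  have := hR.isBezout
  obtain ⟨s, hs⟩ := exists_dotProduct_dvd a
  choose a' ha' using hs
  obtain ⟨t, ht⟩ := exists_dotProduct_dvd (b - (s ⬝ᵥ b) • a')
  obtain ⟨p, q, x, y, h₁, h₂, h₃, -⟩ :=
    hR (s ⬝ᵥ a) (s ⬝ᵥ b) (t ⬝ᵥ (b - (s ⬝ᵥ b) • a'))
  have ha : a = (s ⬝ᵥ a) • a' := funext ha'
  have hta : t ⬝ᵥ a = (s ⬝ᵥ a) * (t ⬝ᵥ a') := by
    conv_lhs => rw [ha]
    rw [dotProduct_smul, smul_eq_mul]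
  have key : x * ((p • s + q • (t - (t ⬝ᵥ a') • s)) ⬝ᵥ a) +
      y * ((p • s + q • (t - (t ⬝ᵥ a') • s)) ⬝ᵥ b) =
      p * x * (s ⬝ᵥ a) + p * y * (s ⬝ᵥ b) + q * y * (t ⬝ᵥ (b - (s ⬝ᵥ b) • a')) := by
    simp only [add_dotProduct, smul_dotProduct, sub_dotProduct, dotProduct_sub, dotProduct_smul,
      smul_eq_mul, hta]
    ring
  refine ⟨x, y, p • s + q • (t - (t ⬝ᵥ a') • s), fun i => ?_⟩
  rw [key]
  refine ⟨?_, ?_⟩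
  · rw [ha' i]
    exact h₁.mul_right _
  · have := dvd_add (h₃.trans (ht i)) (h₂.mul_right (a' i))
    simpa using this

open Matrix in
/-- Over an elementary divisor ring, a greatest common divisor of the entries of a matrix is a
value of the associated bilinear form. -/
theorem IsEDD.exists_bilin_dvd {R ι κ : Type*} [CommRing R] [Fintype ι] [Fintype κ]
    (hR : IsEDD R) (M : Matrix ι κ R) :
    ∃ (r : ι → R) (s : κ → R), ∀ i j, r ⬝ᵥ (M *ᵥ s) ∣ M i j := by
  classical
  suffices H : ∀ T : Finset ι, ∃ (r : ι → R) (s : κ → R),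
      ∀ i ∈ T, ∀ j, r ⬝ᵥ (M *ᵥ s) ∣ M i j by
    obtain ⟨r, s, h⟩ := H Finset.univ
    exact ⟨r, s, fun i => h i (Finset.mem_univ i)⟩
  intro T
  induction T using Finset.induction_on with
  | empty => exact ⟨0, 0, by simp⟩
  | insert k T hk ih =>
    obtain ⟨r, s, hdvd⟩ := ih
    obtain ⟨x, y, t, ht⟩ := hR.exists_dvd_pair (M k) (r ᵥ* M)
    have key : (x • Pi.single k 1 + y • r) ⬝ᵥ (M *ᵥ t) =
        x * (t ⬝ᵥ M k) + y * (t ⬝ᵥ (r ᵥ* M)) := by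
      rw [add_dotProduct, smul_dotProduct, smul_dotProduct, single_one_dotProduct,
        dotProduct_mulVec, dotProduct_comm t (r ᵥ* M), dotProduct_comm t (M k)]
      rfl
    refine ⟨x • Pi.single k 1 + y • r, t, fun i hi j => ?_⟩
    rw [key]
    rcases Finset.mem_insert.1 hi with rfl | hi'
    · exact (ht j).1
    · refine dvd_trans ?_ (hdvd i hi' j)
      rw [dotProduct_mulVec]
      exact Finset.dvd_sum fun l _ => (ht l).2.mul_right _

open Matrix in
/-- Over a Bézout domain an invertible matrix clears all but one coordinate of a given vector. -/
theorem exists_isUnit_det_mulVec_eq_zero {R ι : Type*} [CommRing R] [IsDomain R] [IsBezout R]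
    [Fintype ι] [DecidableEq ι] (a : ι → R) (i₀ : ι) :
    ∃ P : Matrix ι ι R, IsUnit P.det ∧ ∀ i, i ≠ i₀ → (P *ᵥ a) i = 0 := by
  suffices H : ∀ T : Finset ι, i₀ ∉ T → ∃ P : Matrix ι ι R, IsUnit P.det ∧
      ∀ i ∈ T, (P *ᵥ a) i = 0 by
    obtain ⟨P, hP, h⟩ := H (Finset.univ.erase i₀) (by simp)
    exact ⟨P, hP, fun i hi => h i (by simp [hi])⟩
  intro T
  induction T using Finset.induction_on with
  | empty => exact fun _ => ⟨1, by simp, by simp⟩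
  | insert j T hj ih =>
    intro hT
    rw [Finset.mem_insert, not_or] at hT
    obtain ⟨P, hP, h⟩ := ih hT.2
    obtain ⟨x, y, z, w, hdet, hzero⟩ : ∃ x y z w : R, x * w - y * z = 1 ∧
        z * (P *ᵥ a) i₀ + w * (P *ᵥ a) j = 0 := by
      generalize (P *ᵥ a) i₀ = b
      generalize (P *ᵥ a) j = c
      obtain ⟨s, hs⟩ := exists_dotProduct_dvd ![b, c]
      obtain ⟨b', hb⟩ := hs 0
      obtain ⟨c', hc⟩ := hs 1
      simp only [dotProduct, Fin.sum_univ_two, Matrix.cons_val_zero, Matrix.cons_val_one] at hb hc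
      by_cases hg : s 0 * b + s 1 * c = 0
      · exact ⟨1, 0, 0, 1, by ring, by rw [hc, hg]; ring⟩
      · refine ⟨s 0, s 1, -c', b', mul_left_cancel₀ hg ?_, ?_⟩
        · linear_combination -(s 0) * hb - s 1 * hc
        · linear_combination b' * hc - c' * hb
    let U : Matrix ι (Fin 2) R := (of ![Pi.single i₀ 1, Pi.single j 1])ᵀ
    let V : Matrix (Fin 2) ι R :=
      of ![Pi.single i₀ (x - 1) + Pi.single j y, Pi.single i₀ z + Pi.single j (w - 1)]
    have hji : j ≠ i₀ := Ne.symm hT.1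
    refine ⟨(1 + U * V) * P, ?_, ?_⟩
    · rw [det_mul, det_one_add_mul_comm]
      refine IsUnit.mul ?_ hP
      have : (1 + V * U).det = 1 := by
        have hVU (k l) : (V * U) k l = V k ⬝ᵥ Uᵀ l := rfl
        rw [det_fin_two, ← hdet]
        simp only [Matrix.add_apply, hVU]
        have hV₀ : V 0 = Pi.single i₀ (x - 1) + Pi.single j y := rfl
        have hV₁ : V 1 = Pi.single i₀ z + Pi.single j (w - 1) := rfl
        have hU₀ : Uᵀ 0 = Pi.single i₀ 1 := rfl
        have hU₁ : Uᵀ 1 = Pi.single j 1 := rfl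
        simp [hV₀, hV₁, hU₀, hU₁, hji, hji.symm]
      simp [this]
    · intro i hi
      have hEP : ((1 + U * V) * P) *ᵥ a = P *ᵥ a + U *ᵥ (V *ᵥ (P *ᵥ a)) := by
        simp [← mulVec_mulVec, add_mulVec]
      rw [hEP, Pi.add_apply]
      rcases Finset.mem_insert.1 hi with rfl | hi'
      · have hV : (V *ᵥ (P *ᵥ a)) 1 = z * (P *ᵥ a) i₀ + (w - 1) * (P *ᵥ a) i := by
          change (Pi.single i₀ z + Pi.single i (w - 1)) ⬝ᵥ (P *ᵥ a) = _
          rw [add_dotProduct, single_dotProduct, single_dotProduct]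
        have hU : (U *ᵥ (V *ᵥ (P *ᵥ a))) i = (V *ᵥ (P *ᵥ a)) 1 := by
          generalize V *ᵥ (P *ᵥ a) = f
          simp [U, mulVec, dotProduct, hji]
        rw [hU, hV]
        linear_combination hzero
      · have h1 : i ≠ i₀ := by rintro rfl; exact hT.2 hi'
        have h2 : i ≠ j := by rintro rfl; exact hj hi'
        rw [h i hi', zero_add]
        simp [U, mulVec, dotProduct, h1, h2]

open Matrix in
/-- Over a Bézout domain every unimodular vector is a column of an invertible matrix. -/
theorem exists_isUnit_det_mulVec_eq_single {R ι : Type*} [CommRing R] [IsDomain R] [IsBezout R]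
    [Fintype ι] [DecidableEq ι] {a r : ι → R} (h : r ⬝ᵥ a = 1) (i₀ : ι) :
    ∃ P : Matrix ι ι R, IsUnit P.det ∧ P *ᵥ Pi.single i₀ 1 = a := by
  obtain ⟨P, hP, hz⟩ := exists_isUnit_det_mulVec_eq_zero a i₀
  have hPa : P *ᵥ a = (P *ᵥ a) i₀ • Pi.single i₀ 1 := by
    ext i
    by_cases hi : i = i₀
    · subst hi; simp
    · simp [hi, hz i hi]
  generalize (P *ᵥ a) i₀ = g at hPa
  have ha : a = g • (P⁻¹ *ᵥ Pi.single i₀ 1) := by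
    rw [← mulVec_smul, ← hPa, mulVec_mulVec, nonsing_inv_mul _ hP, one_mulVec]
  have hg : IsUnit g := by
    rw [ha, dotProduct_smul, smul_eq_mul] at h
    exact IsUnit.of_mul_eq_one _ h
  refine ⟨g • P⁻¹, ?_, ?_⟩
  · rw [det_smul]
    exact (hg.pow _).mul (isUnit_nonsing_inv_det _ hP)
  · rw [smul_mulVec, ← ha]

open Matrix in
/-- A nonzero square matrix over an elementary divisor domain is equivalent to a block diagonal
one whose first entry divides the other block. -/
theorem IsEDD.exists_fromBlocks {R n : Type*} [CommRing R] [IsDomain R] [Fintype n]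
    [DecidableEq n] (hR : IsEDD R) (M : Matrix (Unit ⊕ n) (Unit ⊕ n) R) (hM : M ≠ 0) :
    ∃ P Q : Matrix (Unit ⊕ n) (Unit ⊕ n) R, IsUnit P.det ∧ IsUnit Q.det ∧
      ∃ (D : R) (N : Matrix n n R), P * M * Q = D • fromBlocks 1 0 0 N := by
  have := hR.isBezout
  obtain ⟨r, s, hrs⟩ := hR.exists_bilin_dvd M
  set D := r ⬝ᵥ (M *ᵥ s) with hD
  have hD0 : D ≠ 0 := by
    intro h0
    refine hM (ext fun i j => ?_)
    have := hrs i j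
    rw [h0] at this
    simpa using this
  choose M' hM' using hrs
  have hMM : M = D • of M' := by ext i j; simp [hM' i j]
  have h1 : r ⬝ᵥ (of M' *ᵥ s) = 1 := by
    refine mul_left_cancel₀ hD0 ?_
    rw [mul_one, ← smul_eq_mul, ← dotProduct_smul, ← smul_mulVec, ← hMM]
  obtain ⟨Q, hQ, hQs⟩ := exists_isUnit_det_mulVec_eq_single
    (r := r ᵥ* of M') (a := s) (by rw [← dotProduct_mulVec, h1]) (Sum.inl ())
  obtain ⟨P, hP, hPr⟩ := exists_isUnit_det_mulVec_eq_single
    (r := of M' *ᵥ s) (a := r) (by rw [dotProduct_comm, h1]) (Sum.inl ())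
  set K := Pᵀ * of M' * Q with hK
  have hK1 : K (Sum.inl ()) (Sum.inl ()) = 1 := by
    rw [← hQs, ← hPr, ← vecMul_transpose, ← dotProduct_mulVec, mulVec_mulVec, mulVec_mulVec,
      single_one_dotProduct, mulVec_single_one] at h1
    exact h1
  have hK11 : K.toBlocks₁₁ = 1 := by
    ext i j
    simp [toBlocks₁₁, hK1]
  refine ⟨fromBlocks 1 0 (-K.toBlocks₂₁) 1 * Pᵀ, Q * fromBlocks 1 (-K.toBlocks₁₂) 0 1,
    ?_, ?_, D, K.toBlocks₂₂ - K.toBlocks₂₁ * K.toBlocks₁₂, ?_⟩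
  · simpa [det_mul] using hP
  · simpa [det_mul] using hQ
  · have : fromBlocks 1 0 (-K.toBlocks₂₁) 1 * Pᵀ * M * (Q * fromBlocks 1 (-K.toBlocks₁₂) 0 1) =
      D • (fromBlocks 1 0 (-K.toBlocks₂₁) 1 * K * fromBlocks 1 (-K.toBlocks₁₂) 0 1) := by
      rw [hK, hMM]
      simp only [Matrix.mul_smul, Matrix.smul_mul, Matrix.mul_assoc]
    rw [this]
    congr 1
    conv_lhs => rw [← fromBlocks_toBlocks K, hK11]
    simp [fromBlocks_multiply, sub_eq_neg_add]

open Matrix in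
/-- Smith normal form of square matrices over an elementary divisor domain. -/
theorem IsEDD.exists_smith_normal_form {R : Type*} [CommRing R] [IsDomain R] (hR : IsEDD R)
    (n : ℕ) (M : Matrix (Fin n) (Fin n) R) :
    ∃ P Q : Matrix (Fin n) (Fin n) R, IsUnit P.det ∧ IsUnit Q.det ∧
      ∃ d : Fin n → R, (∀ i j, i ≤ j → d i ∣ d j) ∧ P * M * Q = diagonal d := by
  induction n with
  | zero => exact ⟨1, 1, by simp, by simp, 0, fun i => i.elim0, by ext i; exact i.elim0⟩
  | succ n ih =>
    by_cases hM : M = 0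
    · exact ⟨1, 1, by simp, by simp, 0, by simp, by simp [hM]⟩
    let e : Unit ⊕ Fin n ≃ Fin (n + 1) :=
      { toFun := Sum.elim (fun _ => 0) Fin.succ
        invFun := Fin.cases (Sum.inl ()) Sum.inr
        left_inv := by rintro (_ | _) <;> rfl
        right_inv := by intro i; cases i using Fin.cases <;> rfl }
    obtain ⟨P, Q, hP, hQ, D, N, h⟩ := hR.exists_fromBlocks (M.submatrix e e) (by
      intro h0
      refine hM (ext fun i j => ?_)
      simpa using congr_fun₂ h0 (e.symm i) (e.symm j))
    obtain ⟨P', Q', hP', hQ', d, hd, h'⟩ := ih N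
    refine ⟨(fromBlocks 1 0 0 P' * P).submatrix e.symm e.symm,
      (Q * fromBlocks 1 0 0 Q').submatrix e.symm e.symm, ?_, ?_, Fin.cons D (D • d), ?_, ?_⟩
    · simpa [det_mul] using ⟨hP', hP⟩
    · simpa [det_mul] using ⟨hQ, hQ'⟩
    · intro i j hij
      cases i using Fin.cases with
      | zero => cases j using Fin.cases <;> simp
      | succ i =>
        cases j using Fin.cases with
        | zero => exact absurd hij (by simp)
        | succ j => simpa using mul_dvd_mul_left D (hd i j (by simpa using hij))
    · have hMe : M = (M.submatrix e e).submatrix e.symm e.symm := by simp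
      rw [hMe, submatrix_mul_equiv, submatrix_mul_equiv]
      have hb : fromBlocks 1 0 0 P' * P * M.submatrix e e * (Q * fromBlocks 1 0 0 Q') =
          D • fromBlocks 1 0 0 (diagonal d) := by
        rw [← h']
        calc _ = fromBlocks 1 0 0 P' * (P * M.submatrix e e * Q) * fromBlocks 1 0 0 Q' := by
              simp only [Matrix.mul_assoc]
          _ = _ := by rw [h]; simp [fromBlocks_multiply]
      rw [hb]
      ext i j
      cases i using Fin.cases <;> cases j using Fin.cases <;>
        simp [e, diagonal_apply, Fin.succ_ne_zero, (Fin.succ_ne_zero _).symm]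

/-- Over an elementary divisor domain, every finite rank matrix factorization
`u·v = v·u = W·1` of a nonzero `W` can be simultaneously diagonalized: there are invertible
matrices `A, B` and elements `d_i, e_i` with `d_i·e_i = W`, `d_i ∣ d_j` for `i ≤ j`,
`A·v·B⁻¹ = diag(d_1,…,d_ρ)` and `B·u·A⁻¹ = diag(e_1,…,e_ρ)`; i.e. every matrix factorization
is strongly isomorphic to a direct sum of elementary ones. -/
theorem matrix_factorization_smith_form
    {R : Type*} [CommRing R] [IsDomain R] (hR : IsEDD R)
    (W : R) (hW : W ≠ 0) (ρ : ℕ) (hρ : 1 ≤ ρ)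
    (u v : Matrix (Fin ρ) (Fin ρ) R)
    (huv : u * v = W • (1 : Matrix (Fin ρ) (Fin ρ) R))
    (hvu : v * u = W • (1 : Matrix (Fin ρ) (Fin ρ) R)) :
    ∃ A B : Matrix (Fin ρ) (Fin ρ) R, IsUnit A.det ∧ IsUnit B.det ∧
      ∃ d e : Fin ρ → R,
        (∀ i, d i * e i = W) ∧
        (∀ i j : Fin ρ, i ≤ j → d i ∣ d j) ∧
        A * v * B⁻¹ = Matrix.diagonal d ∧
        B * u * A⁻¹ = Matrix.diagonal e := by
  obtain ⟨P, Q, hP, hQ, d, hd, h⟩ := hR.exists_smith_normal_form ρ v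
  have hmul : Matrix.diagonal d * (Q⁻¹ * u * P⁻¹) = W • 1 := by
    calc Matrix.diagonal d * (Q⁻¹ * u * P⁻¹) = P * (v * (Q * Q⁻¹) * u) * P⁻¹ := by
          rw [← h]; simp only [Matrix.mul_assoc]
      _ = W • 1 := by
          rw [Matrix.mul_nonsing_inv _ hQ, Matrix.mul_one, hvu, Matrix.mul_smul, Matrix.mul_one,
            Matrix.smul_mul, Matrix.mul_nonsing_inv _ hP]
  have hentry (i j) : d i * (Q⁻¹ * u * P⁻¹) i j = (W • (1 : Matrix (Fin ρ) (Fin ρ) R)) i j := by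
    rw [← hmul, Matrix.diagonal_mul]
  have hdiag (i) : d i * (Q⁻¹ * u * P⁻¹) i i = W := by simpa using hentry i i
  refine ⟨P, Q⁻¹, hP, Matrix.isUnit_nonsing_inv_det _ hQ, d,
    fun i => (Q⁻¹ * u * P⁻¹) i i, hdiag, hd, ?_, ?_⟩
  · rw [Matrix.nonsing_inv_nonsing_inv _ hQ, h]
  · ext i j
    by_cases hij : i = j
    · subst hij; simp
    · have hd0 : d i ≠ 0 := fun h0 => hW (by rw [← hdiag i, h0, zero_mul])
      have := hentry i j
      rw [Matrix.smul_apply, Matrix.one_apply_ne hij, smul_zero] at this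
      rw [Matrix.diagonal_apply_ne _ hij]
      exact (mul_eq_zero.1 this).resolve_left hd0
end

section
/- Let R be an elementary divisor domain, W a nonzero element of R, and v_1,…,v_m divisors of W with u_i·v_i = W, such that v_i and v_j are coprime for all i ≠ j (there exist x, y ∈ R with x·v_i + y·v_j = 1). Then there exist invertible matrices P, Q ∈ GL(m,R) such that P·diag(v_1,…,v_m)·Q⁻¹ = diag(1,…,1, v_1·v_2⋯v_m) and Q·diag(u_1,…,u_m)·P⁻¹ = diag(W,…,W, e), where e ∈ R satisfies (v_1⋯v_m)·e = W. In particular, the direct sum of elementary factorizations e_{v_1} ⊕ … ⊕ e_{v_m} of W is strongly isomorphic to e_1^{⊕(m−1)} ⊕ e_{v_1⋯v_m}. -/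
/-- Two families `f, g : ι → R` are diagonally equivalent if the diagonal endomorphisms they
define on `ι → R` agree up to linear automorphisms of source and target. -/
def DiagEquiv {ι R : Type*} [CommRing R] (f g : ι → R) : Prop :=
  ∃ P Q : (ι → R) ≃ₗ[R] (ι → R), ∀ z, P (f * z) = g * Q z

namespace DiagEquiv

variable {ι R : Type*} [CommRing R]

theorem refl (f : ι → R) : DiagEquiv f f :=
  ⟨LinearEquiv.refl R _, LinearEquiv.refl R _, fun _ => rfl⟩

theorem trans {f g h : ι → R} (hfg : DiagEquiv f g) (hgh : DiagEquiv g h) : DiagEquiv f h := by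
  obtain ⟨P, Q, hPQ⟩ := hfg
  obtain ⟨P', Q', hPQ'⟩ := hgh
  exact ⟨P.trans P', Q.trans Q', fun z => by simp [hPQ, hPQ']⟩

/-- The linear map acting on the coordinates `i, j` by the matrix `!![p, q; r, s]` and trivially
on the other coordinates. -/
def blockMap [DecidableEq ι] (i j : ι) (p q r s : R) : (ι → R) →ₗ[R] (ι → R) where
  toFun z k := if k = i then p * z i + q * z j else if k = j then r * z i + s * z j else z k
  map_add' z w := by
    ext k
    simp only [Pi.add_apply]
    split_ifs <;> ring
  map_smul' c z := by
    ext k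
    simp only [Pi.smul_apply, smul_eq_mul, RingHom.id_apply]
    split_ifs <;> ring

theorem blockMap_apply [DecidableEq ι] (i j : ι) (p q r s : R) (z : ι → R) (k : ι) :
    blockMap i j p q r s z k =
      if k = i then p * z i + q * z j else if k = j then r * z i + s * z j else z k := rfl

theorem blockMap_comp_adjugate [DecidableEq ι] {i j : ι} (hij : i ≠ j) {p q r s : R}
    (h : p * s - q * r = 1) :
    blockMap i j p q r s ∘ₗ blockMap i j s (-q) (-r) p = LinearMap.id := by
  refine LinearMap.ext fun z => funext fun k => ?_
  simp only [LinearMap.comp_apply, blockMap_apply, LinearMap.id_apply, if_true, if_neg hij.symm]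
  split_ifs with h₁ h₂
  · subst h₁; linear_combination z k * h
  · subst h₂; linear_combination z k * h
  · rfl

/-- `blockMap` as a linear automorphism, for a block of determinant one. -/
def blockEquiv [DecidableEq ι] {i j : ι} (hij : i ≠ j) {p q r s : R}
    (h : p * s - q * r = 1) : (ι → R) ≃ₗ[R] (ι → R) :=
  LinearEquiv.ofLinearMap (blockMap i j p q r s) (blockMap i j s (-q) (-r) p)
    (blockMap_comp_adjugate hij h)
    (by
      simpa using blockMap_comp_adjugate (p := s) (q := -q) (r := -r) (s := p) hij
        (by linear_combination h))

theorem of_isCoprime [DecidableEq ι] {f : ι → R} {i j : ι} (hij : i ≠ j)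
    (h : IsCoprime (f i) (f j)) :
    DiagEquiv f fun k => if k = i then 1 else if k = j then f i * f j else f k := by
  obtain ⟨x, y, hxy⟩ := h
  refine ⟨blockEquiv hij (p := x) (q := y) (r := -f j) (s := f i) (by linear_combination hxy),
    blockEquiv hij (p := x * f i) (q := y * f j) (r := -1) (s := 1) (by linear_combination hxy),
    fun z => funext fun k => ?_⟩
  change blockMap i j x y (-f j) (f i) (f * z) k =
    _ * blockMap i j (x * f i) (y * f j) (-1) 1 z k
  simp only [blockMap_apply, Pi.mul_apply]
  split_ifs <;> ring

theorem of_pairwise_isCoprime [DecidableEq ι] {v : ι → R}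
    (hv : Pairwise fun i j => IsCoprime (v i) (v j)) {l : ι} (s : Finset ι) (hl : l ∉ s) :
    DiagEquiv v fun k => if k ∈ s then 1 else if k = l then v l * ∏ j ∈ s, v j else v k := by
  induction s using Finset.induction_on with
  | empty =>
    convert refl v using 1
    ext k
    simp +contextual
  | insert i s hi ih =>
    obtain ⟨hli, hls⟩ : l ≠ i ∧ l ∉ s := by simpa using hl
    refine (ih hls).trans ?_
    convert of_isCoprime hli.symm ?_ using 1
    · ext k
      by_cases hki : k = i
      · simp [hki]
      by_cases hkl : k = l
      · subst hkl
        simp [hli, hls, hi, hli.symm, Finset.prod_insert hi]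
        ring
      · simp [hki, hkl]
    · simpa [hi, hls, hli.symm] using
        (hv hli.symm).mul_right (IsCoprime.prod_right fun j hj => hv (by rintro rfl; exact hi hj))

theorem exists_matrix [Fintype ι] [DecidableEq ι] {f g : ι → R} (h : DiagEquiv f g) :
    ∃ P Q : Matrix ι ι R, IsUnit P.det ∧ IsUnit Q.det ∧
      P * Matrix.diagonal f = Matrix.diagonal g * Q := by
  obtain ⟨P, Q, hPQ⟩ := h
  refine ⟨LinearMap.toMatrix' P.toLinearMap, LinearMap.toMatrix' Q.toLinearMap, ?_, ?_, ?_⟩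
  · rw [LinearMap.det_toMatrix']
    exact P.isUnit_det'
  · rw [LinearMap.det_toMatrix']
    exact Q.isUnit_det'
  · refine Matrix.ext_of_mulVec_single fun i => ?_
    have hdiag (d z : ι → R) : (Matrix.diagonal d).mulVec z = d * z :=
      funext fun k => Matrix.mulVec_diagonal d z k
    simp only [← Matrix.mulVec_mulVec, LinearMap.toMatrix'_mulVec, hdiag]
    exact hPQ _

end DiagEquiv

/-- A strong isomorphism of diagonal matrix factorizations of `W` is determined by its effect on
one of the two factors. -/
theorem Matrix.diagonal_conj_of_mul_eq {ι R : Type*} [Fintype ι] [DecidableEq ι] [CommRing R]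
    [IsDomain R] {W : R} (hW : W ≠ 0) {u v u' v' : ι → R} (huv : ∀ i, u i * v i = W)
    (huv' : ∀ i, u' i * v' i = W) {P Q : Matrix ι ι R} (hP : IsUnit P.det)
    (h : P * diagonal v = diagonal v' * Q) :
    Q * diagonal u * P⁻¹ = diagonal u' := by
  have hWW : diagonal v * diagonal u = W • (1 : Matrix ι ι R) := by
    simp [diagonal_mul_diagonal, mul_comm (v _), huv, smul_one_eq_diagonal]
  have key : diagonal v' * (Q * diagonal u * P⁻¹) = diagonal v' * diagonal u' := by
    have hWW' : diagonal v' * diagonal u' = W • (1 : Matrix ι ι R) := by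
      simp [diagonal_mul_diagonal, mul_comm (v' _), huv', smul_one_eq_diagonal]
    rw [hWW', ← mul_assoc, ← mul_assoc, ← h, mul_assoc P, hWW]
    simp [mul_nonsing_inv P hP]
  ext i j
  have hij := congrFun (congrFun key i) j
  rw [diagonal_mul, diagonal_mul] at hij
  refine mul_left_cancel₀ (fun h0 => hW ?_) hij
  rw [← huv' i, h0, mul_zero]

/-- Over an elementary divisor domain, if `v_1,…,v_m` are pairwise coprime divisors of a
nonzero `W` with `u_i·v_i = W`, then the direct sum of elementary factorizations
`e_{v_1} ⊕ … ⊕ e_{v_m}` is strongly isomorphic to `e_1^{⊕(m-1)} ⊕ e_{v_1⋯v_m}`: there are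
invertible `P, Q` with `P·diag(v)·Q⁻¹ = diag(1,…,1,v_1⋯v_m)` and
`Q·diag(u)·P⁻¹ = diag(W,…,W,e)` where `(v_1⋯v_m)·e = W`. -/
theorem coprime_elementary_factorizations_sum
    {R : Type*} [CommRing R] [IsDomain R] (hR : IsEDD R)
    (W : R) (hW : W ≠ 0) (m : ℕ) (hm : 1 ≤ m)
    (u v : Fin m → R) (huv : ∀ i, u i * v i = W)
    (hcop : ∀ i j : Fin m, i ≠ j → ∃ x y : R, x * v i + y * v j = 1) :
    ∃ P Q : Matrix (Fin m) (Fin m) R, IsUnit P.det ∧ IsUnit Q.det ∧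
      ∃ e : R, (∏ i, v i) * e = W ∧
        P * Matrix.diagonal v * Q⁻¹ =
          Matrix.diagonal (fun i : Fin m => if (i : ℕ) < m - 1 then 1 else ∏ j, v j) ∧
        Q * Matrix.diagonal u * P⁻¹ =
          Matrix.diagonal (fun i : Fin m => if (i : ℕ) < m - 1 then W else e) := by
  have hco : Pairwise fun i j => IsCoprime (v i) (v j) := fun i j hij => hcop i j hij
  obtain ⟨e, he⟩ : ∏ i, v i ∣ W :=
    Finset.prod_dvd_of_coprime (fun i _ j _ hij => hco hij)
      fun i _ => ⟨u i, by rw [mul_comm, huv]⟩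
  let l : Fin m := ⟨m - 1, by omega⟩
  have hl (k : Fin m) : (k : ℕ) < m - 1 ↔ k ≠ l := by
    rw [Ne, Fin.ext_iff]
    change _ ↔ ¬ (k : ℕ) = m - 1
    omega
  have hequiv : DiagEquiv v fun i : Fin m => if (i : ℕ) < m - 1 then 1 else ∏ j, v j := by
    convert DiagEquiv.of_pairwise_isCoprime hco _ (Finset.notMem_erase l Finset.univ) using 1
    ext k
    by_cases hk : k = l
    · simp [hl, hk, Finset.mul_prod_erase Finset.univ v (Finset.mem_univ l)]
    · simp [hl, hk]
  obtain ⟨P, Q, hP, hQ, hPQ⟩ := hequiv.exists_matrix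
  refine ⟨P, Q, hP, hQ, e, he.symm, ?_, ?_⟩
  · rw [hPQ, Matrix.mul_nonsing_inv_cancel_right _ _ hQ]
  · refine Matrix.diagonal_conj_of_mul_eq hW huv (fun i => ?_) hP hPQ
    split_ifs
    · rw [mul_one]
    · rw [mul_comm, he]
end

section
/- Let R be an elementary divisor domain and W a nonzero element of R. Let v_1, v_2 be divisors of W with u_1·v_1 = u_2·v_2 = W, let d be a greatest common divisor of v_1 and v_2, write v_1 = d·b and v_2 = d·c, and let r ∈ R. Consider the 2×2 matrices A = [[−v_1, 0],[r·b, u_2]] and B = [[−u_1, 0],[r·c, v_2]] (so that A·B = B·A = W·I₂, encoding the mapping cone of the morphism e_{v_1} → e_{v_2} determined by r). Then there exist ξ, ζ ∈ R and invertible matrices P, Q ∈ GL(2,R) such that: ξ is a greatest common divisor of the entries v_1, u_2, r·b of A; ξ·ζ = −v_1·u_2 = det A; P·A·Q⁻¹ = diag(ξ, ζ); and Q·B·P⁻¹ = diag(η_1, η_2) where ξ·η_1 = W and ζ·η_2 = W. Moreover ξ is associated in divisibility to g·b, where g is a greatest common divisor of the five elements v_1, v_2, u_1, u_2, r. In particular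 the mapping cone C(f) is strongly isomorphic to the direct sum of elementary factorizations e_ξ ⊕ e_ζ. -/
/-- An elementary divisor domain is a Bézout domain: elements all of whose common divisors are
units generate the unit ideal. -/
theorem IsEDD.isCoprime {R : Type*} [CommRing R] (hR : IsEDD R) {b c : R}
    (h : ∀ e : R, e ∣ b → e ∣ c → IsUnit e) : IsCoprime b c := by
  obtain ⟨p, q, x, y, hb, -, hc, -⟩ := hR b 0 c
  obtain ⟨w, hw⟩ := (h _ hb hc).exists_left_inv
  exact ⟨w * p * x, w * q * y, by linear_combination hw⟩

/-- Simultaneous diagonalization of `[[-d, 0], [r, k]]` and `[[-k, 0], [r, d]]` when the row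
`(q, p)` and the column `(y, x)` pair to `1` through the former. -/
theorem exists_simultaneous_diagonalization {R : Type*} [CommRing R] (b c g d k r p q x y : R)
    (h : p * x * k + p * y * r - q * y * d = 1) :
    ∃ P Q : Matrix (Fin 2) (Fin 2) R, IsUnit P.det ∧ IsUnit Q.det ∧
      P * !![-(g * d * b), 0; g * r * b, g * k * b] * Q⁻¹ =
        Matrix.diagonal ![g * b, -(g * b * d * k)] ∧
      Q * !![-(g * k * c), 0; g * r * c, g * d * c] * P⁻¹ =
        Matrix.diagonal ![g * c * d * k, -(g * c)] := by
  have hP : !![q, p; -(r * y + k * x), -(d * y)] * !![-(d * y), -p; r * y + k * x, q] = 1 := by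
    ext i j
    fin_cases i <;> fin_cases j <;> simp [Matrix.mul_apply]
    · linear_combination h
    · ring
    · ring
    · linear_combination h
  have hQ : !![p * r - q * d, p * k; -x, y] * !![y, -(p * k); x, p * r - q * d] = 1 := by
    ext i j
    fin_cases i <;> fin_cases j <;> simp [Matrix.mul_apply]
    · linear_combination h
    · ring
    · ring
    · linear_combination h
  refine ⟨!![q, p; -(r * y + k * x), -(d * y)], !![p * r - q * d, p * k; -x, y],
    Matrix.isUnit_det_of_right_inverse hP, Matrix.isUnit_det_of_right_inverse hQ, ?_, ?_⟩
  · rw [Matrix.inv_eq_right_inv hQ]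
    ext i j
    fin_cases i <;> fin_cases j <;> simp [Matrix.mul_apply]
    · linear_combination g * b * h
    · ring
    · ring
    · linear_combination -(g * b * d * k) * h
  · rw [Matrix.inv_eq_right_inv hP]
    ext i j
    fin_cases i <;> fin_cases j <;> simp [Matrix.mul_apply]
    · linear_combination g * c * d * k * h
    · ring
    · ring
    · linear_combination -(g * c) * h

/-- Decomposition of the mapping cone of a morphism `e_{v₁} → e_{v₂}` of elementary matrix
factorizations of `W` determined by `r ∈ R`: the cone matrices
`A = [[-v₁,0],[r·b,u₂]]`, `B = [[-u₁,0],[r·c,v₂]]` (where `v₁ = d·b`, `v₂ = d·c` with `d` a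
gcd of `v₁, v₂`) are simultaneously diagonalizable to `diag(ξ,ζ)` and `diag(η₁,η₂)`, where
`ξ` is a gcd of `v₁, u₂, r·b`, `ξ·ζ = -(v₁·u₂)`, `ξ·η₁ = W`, `ζ·η₂ = W`, and `ξ` is
associated in divisibility to `g·b` for any gcd `g` of `v₁, v₂, u₁, u₂, r`. Hence
`C(f) ≅ e_ξ ⊕ e_ζ` strongly. -/
theorem cone_of_elementary_factorization_morphism_decomposes
    {R : Type*} [CommRing R] [IsDomain R] (hR : IsEDD R)
    (W : R) (hW : W ≠ 0) (v₁ v₂ u₁ u₂ d b c r : R)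
    (h₁ : u₁ * v₁ = W) (h₂ : u₂ * v₂ = W)
    (hd₁ : d ∣ v₁) (hd₂ : d ∣ v₂) (hdg : ∀ e : R, e ∣ v₁ → e ∣ v₂ → e ∣ d)
    (hb : v₁ = d * b) (hc : v₂ = d * c) :
    ∃ ξ ζ η₁ η₂ : R, ∃ P Q : Matrix (Fin 2) (Fin 2) R,
      IsUnit P.det ∧ IsUnit Q.det ∧
      (ξ ∣ v₁ ∧ ξ ∣ u₂ ∧ ξ ∣ r * b ∧
        ∀ e : R, e ∣ v₁ → e ∣ u₂ → e ∣ r * b → e ∣ ξ) ∧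
      ξ * ζ = -(v₁ * u₂) ∧
      P * !![-v₁, 0; r * b, u₂] * Q⁻¹ = Matrix.diagonal ![ξ, ζ] ∧
      Q * !![-u₁, 0; r * c, v₂] * P⁻¹ = Matrix.diagonal ![η₁, η₂] ∧
      ξ * η₁ = W ∧ ζ * η₂ = W ∧
      ∀ g : R, (g ∣ v₁ ∧ g ∣ v₂ ∧ g ∣ u₁ ∧ g ∣ u₂ ∧ g ∣ r ∧
          ∀ e : R, e ∣ v₁ → e ∣ v₂ → e ∣ u₁ → e ∣ u₂ → e ∣ r → e ∣ g) →
        (ξ ∣ g * b ∧ g * b ∣ ξ) := by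
  have hv₁ : v₁ ≠ 0 := by rintro rfl; exact hW (by rw [← h₁, mul_zero])
  have hd : d ≠ 0 := by rintro rfl; exact hv₁ (by rw [hb, zero_mul])
  obtain ⟨s, t, hst⟩ : IsCoprime b c := hR.isCoprime fun e heb hec => by
    have hde : d * e ∣ d * 1 := by
      rw [mul_one]
      exact hdg _ (hb ▸ mul_dvd_mul_left d heb) (hc ▸ mul_dvd_mul_left d hec)
    exact isUnit_of_dvd_one ((mul_dvd_mul_iff_left hd).1 hde)
  have hub : u₁ * b = u₂ * c := mul_left_cancel₀ hd (by
    linear_combination h₁ - h₂ - u₁ * hb + u₂ * hc)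
  obtain ⟨k, hk₂, hk₁⟩ : ∃ k, u₂ = k * b ∧ u₁ = k * c :=
    ⟨s * u₂ + t * u₁, by linear_combination -u₂ * hst - t * hub,
      by linear_combination -u₁ * hst + s * hub⟩
  subst hk₁ hk₂ hb hc
  obtain ⟨p, q, x, y, hgk, hgr, hgd, hg⟩ := hR k r (-d)
  obtain ⟨g, hg_def⟩ : ∃ g, g = p * x * k + p * y * r + q * y * -d := ⟨_, rfl⟩
  rw [← hg_def] at hgk hgr hgd hg
  rw [dvd_neg] at hgd
  simp only [dvd_neg] at hg
  obtain ⟨k', rfl⟩ := hgk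
  obtain ⟨r', rfl⟩ := hgr
  obtain ⟨d', rfl⟩ := hgd
  have hg₀ : g ≠ 0 := left_ne_zero_of_mul hd
  have hone : p * x * k' + p * y * r' - q * y * d' = 1 :=
    mul_left_cancel₀ hg₀ (by linear_combination -hg_def)
  obtain ⟨P, Q, hP, hQ, hA, hB⟩ := exists_simultaneous_diagonalization b c g d' k' r' p q x y hone
  refine ⟨g * b, -(g * b * d' * k'), g * c * d' * k', -(g * c), P, Q, hP, hQ,
    ⟨⟨d', by ring⟩, ⟨k', by ring⟩, ⟨r', by ring⟩, fun e he₁ he₂ he₃ => ?_⟩,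
    by ring, hA, hB, by rw [← h₁]; ring, by rw [← h₁]; ring, ?_⟩
  · have : g * b = p * x * (g * k' * b) + p * y * (g * r' * b) - q * y * (g * d' * b) := by
      linear_combination -(g * b) * hone
    rw [this]
    exact dvd_sub (dvd_add (he₂.mul_left _) (he₃.mul_left _)) (he₁.mul_left _)
  · rintro g' ⟨hv₁', hv₂', hu₁', hu₂', hr', hg'⟩
    have of_mul {e a : R} (hab : e ∣ a * b) (hac : e ∣ a * c) : e ∣ a := by
      have : a = s * (a * b) + t * (a * c) := by linear_combination -a * hst
      rw [this]
      exact dvd_add (hab.mul_left _) (hac.mul_left _)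
    exact ⟨mul_dvd_mul_right (hg' g ⟨d' * b, by ring⟩ ⟨d' * c, by ring⟩ ⟨k' * c, by ring⟩
        ⟨k' * b, by ring⟩ ⟨r', rfl⟩) b,
      mul_dvd_mul_right (hg g' (of_mul hu₂' hu₁') hr' (of_mul hv₁' hv₂')) b⟩
end
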